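/- An orientation reversing homeomorphism f of the circle is strongly reversible in Homeo(S¹) if and only if there exists an orientation reversing homeomorphism h of the circle that interchanges the two fixed points of f and satisfies h ∘ f² ∘ h⁻¹ = f⁻². -/

import Mathlib

noncomputable section

open scoped Classical

local instance : Fact ((0:ℝ) < 1) := ⟨zero_lt_one⟩

/-- The circle `S¹`, realised as `ℝ / ℤ`. -/
abbrev S1 := AddCircle (1 : ℝ)

/-- `F` is a (monotone, degree one) lift of the circle homeomorphism `f`. -/
def IsLiftOf (f : S1 ≃ₜ S1) (F : CircleDeg1Lift) : Prop :=
  ∀ x : ℝ, f (x : S1) = ((F x : ℝ) : S1)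

/-- A circle homeomorphism is orientation preserving iff it admits a monotone degree one lift. -/
def OrientationPreserving (f : S1 ≃ₜ S1) : Prop :=
  ∃ F : CircleDeg1Lift, IsLiftOf f F

/-- A circle homeomorphism is orientation reversing iff it admits a strictly decreasing
degree `-1` lift. -/
def OrientationReversing (f : S1 ≃ₜ S1) : Prop :=
  ∃ F : ℝ → ℝ, StrictAnti F ∧ (∀ x : ℝ, F (x + 1) = F x - 1) ∧
    ∀ x : ℝ, f (x : S1) = ((F x : ℝ) : S1)

/-- `f` has (Poincaré) rotation number `r` (mod 1): some lift has translation number `r`. -/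
def HasRotationNumber (f : S1 ≃ₜ S1) (r : ℝ) : Prop :=
  ∃ F : CircleDeg1Lift, IsLiftOf f F ∧ F.translationNumber = r

/-- An involution. -/
def IsInvolution (f : S1 ≃ₜ S1) : Prop := ∀ x, f (f x) = x

/-- The canonical representative of a point of the circle in `[0, 1)`. -/
def rep (x : S1) : ℝ := (AddCircle.equivIco 1 0 x : ℝ)

/-- The signature of a circle homeomorphism with respect to a lift `F`; when `F` is the
(unique) lift with a fixed point of an orientation preserving homeomorphism with a fixed
point, this is the signature function `Δ_f : S¹ → {-1, 0, 1}`. -/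
def signature (F : CircleDeg1Lift) (x : S1) : ℝ := Real.sign (F (rep x) - rep x)

/-- Strong reversibility in `Homeo⁺(S¹)`. -/
def StronglyReversiblePlus (f : S1 ≃ₜ S1) : Prop :=
  ∃ σ : S1 ≃ₜ S1, OrientationPreserving σ ∧ IsInvolution σ ∧ ∀ x, σ (f (σ x)) = f.symm x

/-- Strong reversibility in the full group `Homeo(S¹)`. -/
def StronglyReversible (f : S1 ≃ₜ S1) : Prop :=
  ∃ τ : S1 ≃ₜ S1, IsInvolution τ ∧ ∀ x, τ (f (τ x)) = f.symm x

lemma S1.exists_int_of_coe_eq {x y : ℝ} (h : (x : S1) = (y : S1)) : ∃ n : ℤ, x = y + n := by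
  rw [← sub_eq_zero, ← AddCircle.coe_sub, AddCircle.coe_eq_zero_iff] at h
  obtain ⟨n, hn⟩ := h
  exact ⟨n, by simp at hn; linarith⟩

lemma S1.coe_add_intCast (x : ℝ) (n : ℤ) : ((x + n : ℝ) : S1) = (x : S1) := by
  simp

lemma S1.coe_surjective (x : S1) : ∃ r : ℝ, (r : S1) = x := QuotientAddGroup.mk_surjective x

/-- A continuous integer-valued function on the line is constant. -/
lemma eq_of_continuous_of_forall_int {D : ℝ → ℝ} (hD : Continuous D)
    (hint : ∀ x, ∃ n : ℤ, D x = n) (x y : ℝ) : D x = D y := by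
  have hd : IsDiscrete (Set.range ((↑) : ℤ → ℝ)) :=
    ⟨(Int.isClosedEmbedding_coe_real.isEmbedding.toHomeomorph.symm.isEmbedding).discreteTopology⟩
  refine isPreconnected_univ.constant_of_mapsTo hd hD.continuousOn (fun z _ => ?_)
    (Set.mem_univ x) (Set.mem_univ y)
  obtain ⟨n, hn⟩ := hint z
  exact ⟨n, hn.symm⟩

/-- Every continuous self-map of the circle has a continuous lift. -/
lemma exists_continuous_lift {g : S1 → S1} (hg : Continuous g) :
    ∃ G : ℝ → ℝ, Continuous G ∧ ∀ x : ℝ, g (x : S1) = (G x : S1) := by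
  obtain ⟨e, he⟩ := S1.coe_surjective (g ((0 : ℝ) : S1))
  obtain ⟨G, ⟨-, hG⟩, -⟩ := (AddCircle.isCoveringMap_coe (1 : ℝ)).existsUnique_continuousMap_lifts
    (⟨fun x : ℝ => g (x : S1), hg.comp (AddCircle.continuous_mk' 1)⟩ : C(ℝ, S1)) 0 e he
  exact ⟨G, G.continuous, fun x => (congrFun hG x).symm⟩

lemma exists_degree {g : S1 → S1} {G : ℝ → ℝ} (hG : Continuous G)
    (hl : ∀ x : ℝ, g (x : S1) = (G x : S1)) : ∃ d : ℤ, ∀ x, G (x + 1) = G x + d := by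
  have hint : ∀ x, ∃ n : ℤ, G (x + 1) - G x = n := by
    intro x
    obtain ⟨n, hn⟩ := S1.exists_int_of_coe_eq (x := G (x + 1)) (y := G x) (by
      rw [← hl, ← hl]; simp)
    exact ⟨n, by linarith⟩
  obtain ⟨d, hd⟩ := hint 0
  refine ⟨d, fun x => ?_⟩
  have := eq_of_continuous_of_forall_int (D := fun x => G (x + 1) - G x) (by fun_prop) hint x 0
  linarith

lemma add_intCast_of_degree {G : ℝ → ℝ} {d : ℤ} (hG : ∀ x, G (x + 1) = G x + d) (x : ℝ) (n : ℤ) :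
    G (x + n) = G x + n * d := by
  induction n using Int.induction_on with
  | zero => simp
  | succ k ih =>
    have := hG (x + k)
    push_cast at *
    rw [← add_assoc, this, ih]; ring
  | pred k ih =>
    have := hG (x + (-k - 1))
    push_cast at *
    rw [show x + (-k - 1) + 1 = x + -(k : ℝ) by ring, ih] at this
    linarith

/-- A circle homeomorphism has an increasing lift of degree one or a decreasing lift of
degree minus one. -/
lemma exists_strictMono_or_orientationReversing (g : S1 ≃ₜ S1) :
    (∃ G : ℝ → ℝ, StrictMono G ∧ (∀ x, G (x + 1) = G x + 1) ∧ ∀ x : ℝ, g (x : S1) = (G x : S1)) ∨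
      OrientationReversing g := by
  obtain ⟨G, hGc, hG⟩ := exists_continuous_lift g.continuous
  obtain ⟨K, hKc, hK⟩ := exists_continuous_lift g.symm.continuous
  obtain ⟨d, hd⟩ := exists_degree hGc hG
  obtain ⟨e, he⟩ := exists_degree hKc hK
  have hint : ∀ x, ∃ n : ℤ, K (G x) - x = n := by
    intro x
    obtain ⟨n, hn⟩ := S1.exists_int_of_coe_eq (x := K (G x)) (y := x) (by
      rw [← hK, ← hG]; simp)
    exact ⟨n, by linarith⟩
  have hconst := eq_of_continuous_of_forall_int (D := fun x => K (G x) - x) (by fun_prop) hint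
  have hinj : Function.Injective G := by
    intro x y hxy
    have := hconst x y
    rw [hxy] at this
    linarith
  have hde : d * e = 1 := by
    have h1 := hconst (0 + 1) 0
    rw [hd, add_intCast_of_degree he] at h1
    have : (d : ℝ) * e = 1 := by linarith
    exact_mod_cast this
  rcases hGc.strictMono_of_inj hinj with hm | hm
  · left
    refine ⟨G, hm, ?_, hG⟩
    rcases Int.eq_one_or_neg_one_of_mul_eq_one hde with rfl | rfl
    · simpa using hd
    · have := hm (zero_lt_one' ℝ)
      have h2 := hd 0
      simp at h2
      linarith
  · right
    refine ⟨G, hm, ?_, hG⟩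
    rcases Int.eq_one_or_neg_one_of_mul_eq_one hde with rfl | rfl
    · have := hm (zero_lt_one' ℝ)
      have h2 := hd 0
      simp at h2
      linarith
    · intro x
      rw [hd]; push_cast; ring

/-- An orientation preserving involution of the circle with a fixed point is the identity. -/
lemma eq_self_of_involutive_of_lift {k : S1 → S1} (hk : ∀ x, k (k x) = x) {K : ℝ → ℝ}
    (hmono : StrictMono K) (hadd : ∀ x, K (x + 1) = K x + 1)
    (hl : ∀ x : ℝ, k (x : S1) = (K x : S1)) {a : S1} (ha : k a = a) (x : S1) : k x = x := by
  obtain ⟨A, rfl⟩ := S1.coe_surjective a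
  obtain ⟨n, hn⟩ := S1.exists_int_of_coe_eq ((hl A).symm.trans ha)
  obtain ⟨r, rfl⟩ := S1.coe_surjective x
  have hr : ((AddCircle.equivIco 1 A (r : S1) : ℝ) : S1) = r := AddCircle.coe_equivIco
  obtain ⟨hs1, hs2⟩ := (AddCircle.equivIco 1 A (r : S1)).2
  generalize ((AddCircle.equivIco 1 A (r : S1) : ℝ)) = s at hr hs1 hs2
  rw [← hr]
  have hadd' := add_intCast_of_degree (G := K) (d := 1) (by simpa using hadd)
  set L : ℝ → ℝ := fun y => K y - n with hL
  have hLmono : StrictMono L := fun u v huv => by simp only [hL]; linarith [hmono huv]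
  have hLA : L A = A := by simp [hL, hn]
  have hLA1 : L (A + 1) = A + 1 := by simp [hL, hn, hadd]; ring
  have hLl : ∀ y : ℝ, k (y : S1) = (L y : S1) := fun y => by
    rw [hl, ← S1.coe_add_intCast (L y) n]; simp [hL]
  have h1 : A ≤ L s := hLA ▸ hLmono.monotone hs1
  have h2 : L s < A + 1 := hLA1 ▸ hLmono hs2
  have h3 : A ≤ L (L s) := hLA ▸ hLmono.monotone h1
  have h4 : L (L s) < A + 1 := hLA1 ▸ hLmono h2
  have h5 : L (L s) = s := by
    refine (AddCircle.coe_eq_coe_iff_of_mem_Ico (p := (1 : ℝ)) ⟨h3, h4⟩ ⟨hs1, hs2⟩).1 ?_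
    rw [← hLl, ← hLl, hk]
  have h6 : L s = s := by
    rcases lt_trichotomy (L s) s with h | h | h
    · have := hLmono h; linarith
    · exact h
    · have := hLmono h; linarith
  rw [hLl, h6]

lemma orientationReversing_reflection (c : S1) : OrientationReversing (Homeomorph.subLeft c) := by
  obtain ⟨r, rfl⟩ := S1.coe_surjective c
  exact ⟨fun x => r - x, fun x y h => by simp only; linarith, fun x => by ring, fun x => by simp⟩

/-- An orientation reversing homeomorphism lifts to a decreasing homeomorphism of the line with
a prescribed value at one point. -/
lemma OrientationReversing.exists_homeomorph_lift {h : S1 ≃ₜ S1} (hh : OrientationReversing h)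
    {A B : ℝ} (hAB : h (A : S1) = (B : S1)) :
    ∃ H : ℝ ≃ₜ ℝ, StrictAnti H ∧ (∀ x, H (x + 1) = H x - 1) ∧
      (∀ x : ℝ, h (x : S1) = (H x : S1)) ∧ H A = B := by
  obtain ⟨K, hanti, hadd, hl⟩ := hh
  have hadd' := add_intCast_of_degree (G := K) (d := -1) (fun x => by
    rw [hadd]; push_cast; ring)
  obtain ⟨n, hn⟩ := S1.exists_int_of_coe_eq ((hl A).symm.trans hAB)
  set L : ℝ → ℝ := fun y => K y - n with hL
  have hLanti : StrictAnti L := fun u v huv => by simp only [hL]; linarith [hanti huv]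
  have hsurj : Function.Surjective L := by
    intro y
    obtain ⟨x, hx⟩ := S1.coe_surjective (h.symm (y : S1))
    have hx' : h (x : S1) = (y : S1) := by rw [hx]; simp
    obtain ⟨m, hm⟩ := S1.exists_int_of_coe_eq ((hl x).symm.trans hx')
    refine ⟨x + ((m - n : ℤ) : ℝ), ?_⟩
    simp only [hL]
    rw [hadd', hm]; push_cast; ring
  let N : ℝ ≃o ℝ := StrictMono.orderIsoOfSurjective (fun y => - L y)
    (fun u v huv => neg_lt_neg (hLanti huv)) (fun y => by
      obtain ⟨x, hx⟩ := hsurj (-y)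
      exact ⟨x, by simp [hx]⟩)
  have hN : ∀ x, (N.toHomeomorph.trans (Homeomorph.neg ℝ)) x = L x := fun x =>
    neg_neg (L x)
  refine ⟨N.toHomeomorph.trans (Homeomorph.neg ℝ), ?_, ?_, ?_, ?_⟩
  · intro u v huv
    rw [hN, hN]; exact hLanti huv
  · intro x
    simp only [hN, hL, hadd]; ring
  · intro x
    rw [hN, hl, ← S1.coe_add_intCast (L x) n]; simp [hL]
  · rw [hN]; simp [hL, hn]

lemma Homeomorph.strictAnti_symm {H : ℝ ≃ₜ ℝ} (hH : StrictAnti H) : StrictAnti H.symm := by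
  intro x y hxy
  rw [← hH.lt_iff_gt]
  simpa using hxy

/-- The pointwise maximum of a decreasing bijection and its inverse is an involution. -/
lemma max_symm_involutive {H : ℝ ≃ₜ ℝ} (hH : StrictAnti H) :
    Function.Involutive fun x => max (H x) (H.symm x) := by
  intro x
  have hS := Homeomorph.strictAnti_symm hH
  rcases le_total (H.symm x) (H x) with h | h
  · have h1 := hH.antitone h
    simp only [max_eq_left h, Homeomorph.symm_apply_apply]
    rw [Homeomorph.apply_symm_apply] at h1
    exact max_eq_right h1
  · have h1 := hS.antitone h
    simp only [max_eq_right h, Homeomorph.apply_symm_apply]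
    rw [Homeomorph.symm_apply_apply] at h1
    exact max_eq_left h1

/-- An involution reversing `f ∘ f` and preserving a closed set which `f` interchanges with a
complementary closed set can be modified to an involution reversing `f`. -/
lemma exists_involution_of_glue {X : Type*} [TopologicalSpace X] (f : X ≃ₜ X) {I J : Set X}
    (hI : IsClosed I) (hJ : IsClosed J) (hIJ : ∀ x, x ∈ I ∨ x ∈ J) {a b : X}
    (hinter : ∀ x ∈ I, x ∈ J → x = a ∨ x = b) (hfI : ∀ x ∈ I, f x ∈ J) (hfJ : ∀ x ∈ J, f x ∈ I)
    (hfI' : ∀ x ∈ I, f.symm x ∈ J) (hfJ' : ∀ x ∈ J, f.symm x ∈ I) (hfa : f a = a) (hfb : f b = b)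
    {s : X → X} (hs : Continuous s) (hsI : ∀ x ∈ I, s x ∈ I) (hss : ∀ x, s (s x) = x)
    (hsa : s a = b) (hrev : ∀ x, f (f (s (f (f x)))) = s x) :
    ∃ t : X ≃ₜ X, (∀ x, t (t x) = x) ∧ ∀ x, t (f (t x)) = f.symm x := by
  have hfa' : f.symm a = a := by rw [Homeomorph.symm_apply_eq, hfa]
  have hfb' : f.symm b = b := by rw [Homeomorph.symm_apply_eq, hfb]
  have hsb : s b = a := by rw [← hsa, hss]
  set t : X → X := fun x => if x ∈ I then s x else f.symm (s (f.symm x)) with ht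
  have htI : ∀ x ∈ I, t x = s x := fun x hx => by simp [ht, hx]
  have htJ : ∀ x ∈ J, t x = f.symm (s (f.symm x)) := fun x hx => by
    by_cases hxI : x ∈ I
    · rw [htI x hxI]
      rcases hinter x hxI hx with rfl | rfl
      · rw [hfa', hsa, hfb']
      · rw [hfb', hsb, hfa']
    · simp [ht, hxI]
  have htt : ∀ x, t (t x) = x := by
    intro x
    rcases hIJ x with hx | hx
    · rw [htI x hx, htI _ (hsI x hx), hss]
    · rw [htJ x hx, htJ _ (hfI' _ (hsI _ (hfJ' x hx)))]
      have := hrev (f.symm (f.symm (s (f.symm x))))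
      simp only [Homeomorph.apply_symm_apply, hss] at this
      rw [← this]; simp
  have htf : ∀ x, t (f x) = f.symm (t x) := by
    intro x
    rcases hIJ x with hx | hx
    · rw [htI x hx, htJ _ (hfI x hx)]; simp
    · rw [htJ x hx, htI _ (hfJ x hx)]
      have := hrev (f.symm x)
      simp only [Homeomorph.apply_symm_apply] at this
      rw [← this]; simp
  have hcont : Continuous t := by
    have h1 : ContinuousOn t I := hs.continuousOn.congr htI
    have h2 : ContinuousOn t J :=
      (f.symm.continuous.comp (hs.comp f.symm.continuous)).continuousOn.congr htJ
    rw [← continuousOn_univ, ← Set.eq_univ_of_forall (s := I ∪ J) hIJ]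
    exact h1.union_of_isClosed h2 hI hJ
  exact ⟨⟨⟨t, t, htt, htt⟩, hcont, hcont⟩, htt, fun x => by
    change t (f (t x)) = _
    rw [htf, htt]⟩

lemma StronglyReversible.exists_swap {f : S1 ≃ₜ S1} (hf : OrientationReversing f) {a b : S1}
    (hfa : f a = a) (hfb : f b = b) (honly : ∀ x, f x = x → x = a ∨ x = b)
    (hrev : StronglyReversible f) :
    ∃ h : S1 ≃ₜ S1, OrientationReversing h ∧ h a = b ∧ h b = a ∧
      ∀ x, h (f (f (h.symm x))) = f.symm (f.symm x) := by
  obtain ⟨t, htt, htf⟩ := hrev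
  have htt : ∀ x, t (t x) = x := htt
  have hsymm : ∀ x, t.symm x = t x := fun x => by rw [Homeomorph.symm_apply_eq, htt]
  have htf' : ∀ x, t (f x) = f.symm (t x) := fun x => by
    rw [← htf, htt]
  have hfix : ∀ x, f x = x → f (t x) = t x := fun x hx => by
    have := htf' x
    rw [hx, Homeomorph.eq_symm_apply] at this
    exact this
  obtain ⟨F, hFanti, hFadd, hFl⟩ := hf
  rcases honly _ (hfix a hfa) with hta | hta
  · have hff : ∀ x, f (f x) = x := by
      rcases exists_strictMono_or_orientationReversing t with
        ⟨K, hK, hKadd, hKl⟩ | ⟨K, hK, hKadd, hKl⟩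
      · have hid := eq_self_of_involutive_of_lift htt hK hKadd hKl hta
        intro x
        have := htf x
        rw [hid, hid] at this
        rw [this, Homeomorph.apply_symm_apply]
      · have hid : ∀ x, t (f x) = x := by
          refine eq_self_of_involutive_of_lift (k := fun x => t (f x)) (fun x => ?_)
            (hK.comp hFanti) (fun x => ?_) (fun x => ?_) (a := a) (by simp [hfa, hta])
          · rw [htf, Homeomorph.symm_apply_apply]
          · have := hKadd (F x - 1)
            rw [sub_add_cancel] at this
            simp only [Function.comp, hFadd]
            linarith
          · simp only [Function.comp, hFl, hKl]
        have hft : ∀ x, f x = t x := fun x => by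
          rw [← htt (f x), hid]
        intro x
        rw [hft, hft, htt]
    refine ⟨Homeomorph.subLeft (a + b), orientationReversing_reflection _, by simp, by simp,
      fun x => ?_⟩
    rw [hff, Homeomorph.apply_symm_apply, Homeomorph.eq_symm_apply, Homeomorph.eq_symm_apply, hff]
  · have htb : t b = a := by rw [← hta, htt]
    rcases exists_strictMono_or_orientationReversing t with ⟨K, hK, hKadd, hKl⟩ | hK
    · refine ⟨f.trans t, ⟨K ∘ F, fun x y h => hK (hFanti h), fun x => ?_, fun x => ?_⟩,
        by simp [hfa, hta], by simp [hfb, htb], fun x => ?_⟩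
      · have := hKadd (F x - 1)
        rw [sub_add_cancel] at this
        simp only [Function.comp, hFadd]
        linarith
      · simp only [Function.comp, Homeomorph.trans_apply, hFl, hKl]
      · simp [htf', hsymm, htt]
    · exact ⟨t, hK, hta, htb, fun x => by rw [hsymm, htf', htf', htt]⟩

lemma stronglyReversible_of_swap {f : S1 ≃ₜ S1} (hf : OrientationReversing f) {a b : S1}
    (hab : a ≠ b) (hfa : f a = a) (hfb : f b = b) {h : S1 ≃ₜ S1} (hh : OrientationReversing h)
    (hha : h a = b) (hhb : h b = a)
    (hrev : ∀ x, h (f (f (h.symm x))) = f.symm (f.symm x)) : StronglyReversible f := by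
  have hrev' : ∀ x, f (f (h (f (f x)))) = h x := fun x => by
    have := hrev (h x)
    rw [Homeomorph.symm_apply_apply] at this
    rw [this]; simp
  obtain ⟨A, rfl⟩ := S1.coe_surjective a
  obtain ⟨B, rfl, hAB, hBA⟩ : ∃ B : ℝ, (B : S1) = b ∧ A < B ∧ B < A + 1 := by
    have hr : ((AddCircle.equivIco 1 A b : ℝ) : S1) = b := AddCircle.coe_equivIco
    obtain ⟨h1, h2⟩ := (AddCircle.equivIco 1 A b).2
    refine ⟨_, hr, lt_of_le_of_ne h1 fun h => hab ?_, h2⟩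
    rw [← hr, ← h]
  obtain ⟨F, hF, hFadd, hFl, hFA⟩ := hf.exists_homeomorph_lift hfa
  obtain ⟨H, hH, hHadd, hHl, hHA⟩ := hh.exists_homeomorph_lift hha
  have hFs := Homeomorph.strictAnti_symm hF
  have hHs := Homeomorph.strictAnti_symm hH
  have hFB : F B = B - 1 := by
    obtain ⟨n, hn⟩ := S1.exists_int_of_coe_eq ((hFl B).symm.trans hfb)
    have h1 := hF hAB
    have h2 := hF hBA
    rw [hFadd, hFA] at h2
    have h3 : (n : ℝ) < 0 := by linarith
    have h4 : (-2 : ℝ) < n := by linarith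
    have : n = -1 := by
      have h3' : n < 0 := by exact_mod_cast h3
      have h4' : -2 < n := by exact_mod_cast h4
      lia
    rw [hn, this]; push_cast; ring
  have hHB : H B = A := by
    obtain ⟨n, hn⟩ := S1.exists_int_of_coe_eq ((hHl B).symm.trans hhb)
    have h1 := hH hAB
    have h2 := hH hBA
    rw [hHadd, hHA] at h2
    have h3 : (n : ℝ) < 1 := by linarith
    have h4 : (-1 : ℝ) < n := by linarith
    have : n = 0 := by
      have h3' : n < 1 := by exact_mod_cast h3
      have h4' : -1 < n := by exact_mod_cast h4
      lia
    rw [hn, this]; simp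
  have hFB1 : F (B - 1) = B := by
    have := hFadd (B - 1)
    rw [sub_add_cancel] at this
    linarith
  have hFH : ∀ x, F (F (H (F (F x)))) = H x := by
    intro x
    have := eq_of_continuous_of_forall_int (D := fun x => F (F (H (F (F x)))) - H x)
      (by fun_prop) (fun x => by
        obtain ⟨n, hn⟩ := S1.exists_int_of_coe_eq (x := F (F (H (F (F x))))) (y := H x) (by
          simp only [← hFl, ← hHl, hrev'])
        exact ⟨n, by linarith⟩) x A
    simp only [hFA, hHA, hFB, hFB1] at this
    linarith
  have hFHs : ∀ x, F (F (H.symm (F (F x)))) = H.symm x := by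
    intro x
    have := hFH (F.symm (F.symm (H.symm x)))
    simp only [Homeomorph.apply_symm_apply] at this
    rw [this]; simp
  have hHsadd : ∀ x, H.symm (x + 1) = H.symm x - 1 := by
    intro x
    have := hHadd (H.symm x - 1)
    rw [sub_add_cancel, Homeomorph.apply_symm_apply] at this
    rw [Homeomorph.symm_apply_eq]
    linarith
  set T : ℝ → ℝ := fun x => max (H x) (H.symm x) with hT
  have hTT : ∀ x, T (T x) = x := max_symm_involutive hH
  have hTcont : Continuous T := by fun_prop
  have hTanti : Antitone T := fun x y hxy => max_le_max (hH.antitone hxy) (hHs.antitone hxy)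
  have hTadd : ∀ x, T (x + 1) = T x - 1 := fun x => by
    simp only [hT, hHadd, hHsadd, max_sub_sub_right]
  have hTA : T A = B := by
    have : H.symm A = B := by rw [Homeomorph.symm_apply_eq, hHB]
    simp [hT, this, hHA]
  have hTB : T B = A := by rw [← hTA, hTT]
  have hFF : Monotone fun x => F (F x) := hF.antitone.comp hF.antitone
  have hFT : ∀ x, F (F (T (F (F x)))) = T x := fun x => by
    have := hFF.map_max (a := H (F (F x))) (b := H.symm (F (F x)))
    simp only [hFH, hFHs] at this
    exact this
  have hper : Function.Periodic (fun x => ((T x : ℝ) : S1)) 1 := fun x => by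
    simp [hTadd]
  set s : S1 → S1 := hper.lift
  have hsl : ∀ x : ℝ, s (x : S1) = (T x : S1) := fun x => rfl
  have hscont : Continuous s :=
    continuous_coinduced_dom.mpr ((AddCircle.continuous_mk' 1).comp hTcont)
  have hFA' : F.symm A = A := by rw [Homeomorph.symm_apply_eq, hFA]
  have hFB' : F.symm B = B - 1 := by rw [Homeomorph.symm_apply_eq, hFB1]
  have hFB1' : F.symm (B - 1) = B := by rw [Homeomorph.symm_apply_eq, hFB]
  have hFsl : ∀ x : ℝ, f.symm (x : S1) = (F.symm x : S1) := fun x => by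
    rw [Homeomorph.symm_apply_eq, hFl, Homeomorph.apply_symm_apply]
  have hclosed : ∀ u v : ℝ, IsClosed (((↑) : ℝ → S1) '' Set.Icc u v) := fun u v =>
    (isCompact_Icc.image (AddCircle.continuous_mk' 1)).isClosed
  refine exists_involution_of_glue f (I := ((↑) : ℝ → S1) '' Set.Icc A B)
    (J := ((↑) : ℝ → S1) '' Set.Icc (B - 1) A) (hclosed _ _) (hclosed _ _) (fun x => ?_)
    (a := (A : S1)) (b := (B : S1)) ?_ ?_ ?_ ?_ ?_ hfa hfb hscont ?_ ?_ (by rw [hsl, hTA]) ?_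
  · have hr : ((AddCircle.equivIco 1 (B - 1) x : ℝ) : S1) = x := AddCircle.coe_equivIco
    obtain ⟨h1, h2⟩ := (AddCircle.equivIco 1 (B - 1) x).2
    rcases le_total A (AddCircle.equivIco 1 (B - 1) x : ℝ) with h3 | h3
    · exact Or.inl ⟨_, ⟨h3, by linarith⟩, hr⟩
    · exact Or.inr ⟨_, ⟨h1, h3⟩, hr⟩
  · rintro _ ⟨x, ⟨hx1, hx2⟩, rfl⟩ ⟨y, ⟨hy1, hy2⟩, hyx⟩
    obtain ⟨n, hn⟩ := S1.exists_int_of_coe_eq hyx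
    have h1 : (n : ℝ) ≤ 0 := by linarith
    have h2 : (-1 : ℝ) ≤ n := by linarith
    have h1' : n ≤ 0 := by exact_mod_cast h1
    have h2' : -1 ≤ n := by exact_mod_cast h2
    obtain rfl | rfl : n = 0 ∨ n = -1 := by lia
    · left
      congr 1
      simp at hn
      linarith
    · right
      congr 1
      push_cast at hn
      linarith
  · rintro _ ⟨x, ⟨hx1, hx2⟩, rfl⟩
    exact ⟨F x, ⟨hFB ▸ hF.antitone hx2, (hF.antitone hx1).trans_eq hFA⟩, (hFl x).symm⟩
  · rintro _ ⟨x, ⟨hx1, hx2⟩, rfl⟩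
    exact ⟨F x, ⟨hFA.symm.trans_le (hF.antitone hx2), (hF.antitone hx1).trans_eq hFB1⟩,
      (hFl x).symm⟩
  · rintro _ ⟨x, ⟨hx1, hx2⟩, rfl⟩
    exact ⟨F.symm x, ⟨hFB'.symm.trans_le (hFs.antitone hx2), (hFs.antitone hx1).trans_eq hFA'⟩,
      (hFsl x).symm⟩
  · rintro _ ⟨x, ⟨hx1, hx2⟩, rfl⟩
    exact ⟨F.symm x, ⟨hFA'.symm.trans_le (hFs.antitone hx2), (hFs.antitone hx1).trans_eq hFB1'⟩,
      (hFsl x).symm⟩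
  · rintro _ ⟨x, ⟨hx1, hx2⟩, rfl⟩
    exact ⟨T x, ⟨hTB.symm.trans_le (hTanti hx2), (hTanti hx1).trans_eq hTA⟩, (hsl x).symm⟩
  · intro x
    obtain ⟨r, rfl⟩ := S1.coe_surjective x
    rw [hsl, hsl, hTT]
  · intro x
    obtain ⟨r, rfl⟩ := S1.coe_surjective x
    simp only [hFl, hsl, hFT]

/-- An orientation reversing circle homeomorphism `f` (with its two fixed points `a, b`)
is strongly reversible in `Homeo(S¹)` iff some orientation reversing homeomorphism `h`
interchanges the two fixed points of `f` and satisfies `h f² h⁻¹ = f⁻²`. -/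
theorem stmt19 (f : S1 ≃ₜ S1) (hf : OrientationReversing f) (a b : S1) (hab : a ≠ b)
    (hfa : f a = a) (hfb : f b = b) (honly : ∀ x, f x = x → x = a ∨ x = b) :
    StronglyReversible f ↔
      ∃ h : S1 ≃ₜ S1, OrientationReversing h ∧ h a = b ∧ h b = a ∧
        ∀ x, h (f (f (h.symm x))) = f.symm (f.symm x) := by
  exact ⟨StronglyReversible.exists_swap hf hfa hfb honly, fun ⟨_, hh, hha, hhb, hrev⟩ =>
    stronglyReversible_of_swap hf hab hfa hfb hh hha hhb hrev⟩
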